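/- There are infinitely many natural numbers n such that both t_n and t_{n+1} are very triangular. -/

import Mathlib

/-- The n-th triangular number. -/
def triangular (n : ℕ) : ℕ := n * (n + 1) / 2

/-- A natural number is triangular if it is `triangular n` for some `n`. -/
def IsTriangular (m : ℕ) : Prop := ∃ n : ℕ, triangular n = m

/-- The number of 1s in the binary representation of `m` (binary digit sum). -/
def binOnes (m : ℕ) : ℕ := (Nat.digits 2 m).sum

/-- A number is very triangular if it is triangular and its binary digit sum is triangular. -/
def IsVeryTriangular (m : ℕ) : Prop := IsTriangular m ∧ IsTriangular (binOnes m)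

theorem binOnes_two_mul (m : ℕ) : binOnes (2 * m) = binOnes m := by
  rcases Nat.eq_zero_or_pos m with rfl | hm
  · rfl
  · simp [binOnes, Nat.digits_def' (b := 2) (n := 2 * m) (by norm_num) (by lia)]

theorem binOnes_two_mul_add_one (m : ℕ) : binOnes (2 * m + 1) = binOnes m + 1 := by
  have hdiv : (2 * m + 1) / 2 = m := by lia
  have hmod : (2 * m + 1) % 2 = 1 := by lia
  rw [binOnes, Nat.digits_def' (by norm_num) (by lia), hdiv, hmod, List.sum_cons, binOnes, add_comm]

theorem binOnes_two_pow_mul (j m : ℕ) : binOnes (2 ^ j * m) = binOnes m := by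
  induction j with
  | zero => simp
  | succ j ih => rw [pow_succ', mul_assoc, binOnes_two_mul, ih]

theorem binOnes_of_add_one_eq_two_pow {j m : ℕ} (h : m + 1 = 2 ^ j) : binOnes m = j := by
  induction j generalizing m with
  | zero =>
    obtain rfl : m = 0 := by simpa using h
    rfl
  | succ j ih =>
    have hpos : 0 < 2 ^ j := by positivity
    rw [pow_succ'] at h
    obtain rfl : m = 2 * (2 ^ j - 1) + 1 := by lia
    rw [binOnes_two_mul_add_one, ih (by lia)]

/-- If `4 * m + 4 = 2 ^ (j + 2)`, the triangular number of index `4 * m + 2` has digit sum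
`j + 2`. -/
theorem binOnes_triangular_left {j m : ℕ} (h : m + 1 = 2 ^ j) :
    binOnes (triangular (4 * m + 2)) = j + 2 := by
  have key : triangular (4 * m + 2) = 2 * (2 ^ j * (2 * (2 * m) + 1)) + 1 := by
    rw [triangular, ← h]
    exact Nat.div_eq_of_eq_mul_left (by norm_num) (by ring)
  rw [key, binOnes_two_mul_add_one, binOnes_two_pow_mul, binOnes_two_mul_add_one, binOnes_two_mul,
    binOnes_of_add_one_eq_two_pow h]

/-- If `4 * m + 4 = 2 ^ (j + 2)`, the triangular number of index `4 * m + 3` has digit sum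
`j + 2`. -/
theorem binOnes_triangular_right {j m : ℕ} (h : m + 1 = 2 ^ j) :
    binOnes (triangular (4 * m + 2 + 1)) = j + 2 := by
  have key : triangular (4 * m + 2 + 1) = 2 * (2 ^ j * (2 * (2 * m + 1) + 1)) := by
    rw [triangular, ← h]
    exact Nat.div_eq_of_eq_mul_left (by norm_num) (by ring)
  rw [key, binOnes_two_mul, binOnes_two_pow_mul, binOnes_two_mul_add_one, binOnes_two_mul_add_one,
    binOnes_of_add_one_eq_two_pow h]

theorem le_triangular (n : ℕ) : n ≤ triangular n := by
  rw [triangular, Nat.le_div_iff_mul_le (by norm_num)]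
  rcases n with _ | n
  · simp
  · exact Nat.mul_le_mul_left _ (by lia)

theorem stmt9 :
    {n : ℕ | IsVeryTriangular (triangular n) ∧ IsVeryTriangular (triangular (n + 1))}.Infinite := by
  refine Set.infinite_of_forall_exists_gt fun a => ?_
  obtain ⟨j, hj⟩ : ∃ j, triangular (a + 2) = j + 2 :=
    ⟨triangular (a + 2) - 2, by have := le_triangular (a + 2); lia⟩
  obtain ⟨m, hm⟩ : ∃ m, m + 1 = 2 ^ j := ⟨2 ^ j - 1, Nat.sub_add_cancel Nat.one_le_two_pow⟩
  have haj : a ≤ j := by have := le_triangular (a + 2); lia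
  have hjm : j < 2 ^ j := Nat.lt_two_pow_self
  refine ⟨4 * m + 2, ⟨⟨⟨_, rfl⟩, a + 2, ?_⟩, ⟨_, rfl⟩, a + 2, ?_⟩, by lia⟩
  · rw [hj, binOnes_triangular_left hm]
  · rw [hj, binOnes_triangular_right hm]
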